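/- arXiv:1401.3086 — 2 statements merged into one kernel-verified Lean document; each statement's English description precedes it below -/
import Mathlib

section
/- If (u,v) is a critical pair, i.e. (u,v) ∈ 𝒞, then (v,u) is also a critical pair: Z_v ≰ G_u^{[1]}. -/
open MulAction Pointwise

/-- `V`, the `n`-dimensional vector space over the field with 3 elements. -/
abbrev Vec (n : ℕ) := Fin n → ZMod 3

/-- The translation subgroup `V` of `Perm (Vec n)`. -/
def TransGrp (n : ℕ) : Subgroup (Equiv.Perm (Vec n)) :=
  Subgroup.closure {f : Equiv.Perm (Vec n) | ∃ w, ∀ v, f v = v + w}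

/-- The Frobenius group `L = V ⋊ C₂` of order `2·3^n`, acting on `V = Vec n`
by `v ↦ ε·v + w` with `ε = ±1`: it is generated by the translations and negation. -/
def Lgrp (n : ℕ) : Subgroup (Equiv.Perm (Vec n)) :=
  Subgroup.closure ({f : Equiv.Perm (Vec n) | ∃ w, ∀ v, f v = v + w} ∪ {Equiv.neg (Vec n)})

/-- The pointwise stabilizer `G_u^{[s]}` in `G` of the ball of radius `s` around `u`. -/
def ballStab {α : Type*} (Γ : SimpleGraph α) (G : Type*) [Group G] [MulAction G α]
    (u : α) (s : ℕ) : Subgroup G :=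
  ⨅ w ∈ {w : α | Γ.dist u w ≤ s}, stabilizer G w

/-- `Z_{uw} = Ω₁(Z(G_u ∩ G_w))`, the subgroup generated by the elements of order at most 2
of the centre of the arc stabilizer `G_u ∩ G_w`. -/
def Zuw {α : Type*} (G : Type*) [Group G] [MulAction G α] (u w : α) : Subgroup G :=
  Subgroup.closure {g : G |
    g ∈ (stabilizer G u ⊓ stabilizer G w) ⊓
        Subgroup.centralizer ((stabilizer G u ⊓ stabilizer G w : Subgroup G) : Set G) ∧ g ^ 2 = 1}

/-- `Z_u = ⟨Z_{uw}^{G_u}⟩`, the normal closure in `G_u` of the subgroups `Z_{uw}`,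
for `w` a neighbour of `u` (independent of the choice of `w` by arc-transitivity). -/
def Zsub {α : Type*} (Γ : SimpleGraph α) (G : Type*) [Group G] [MulAction G α]
    (u : α) : Subgroup G :=
  Subgroup.closure {k : G | ∃ h ∈ stabilizer G u, ∃ w ∈ Γ.neighborSet u,
    ∃ g ∈ Zuw G u w, k = h * g * h⁻¹}

/-- The critical distance `b = min { d(u,v) : Z_u ≰ G_v^{[1]} }`. -/
noncomputable def critDist {α : Type*} (Γ : SimpleGraph α) (G : Type*) [Group G]
    [MulAction G α] : ℕ :=
  sInf {d : ℕ | ∃ u v : α, Γ.dist u v = d ∧ ¬ Zsub Γ G u ≤ ballStab Γ G v 1}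

/-- `(u,v)` is a critical pair: `d(u,v) = b` and `Z_u ≰ G_v^{[1]}`. -/
def critPair {α : Type*} (Γ : SimpleGraph α) (G : Type*) [Group G] [MulAction G α]
    (u v : α) : Prop :=
  Γ.dist u v = critDist Γ G ∧ ¬ Zsub Γ G u ≤ ballStab Γ G v 1

/-- `(Γ, G)` is locally `L`: for each vertex `u` there is a bijection
`φ : Γ(u) ≃ V` conjugating the permutation group induced by `G_u` on `Γ(u)`
to exactly the permutation group `L` acting on `V`. -/
def LocallyL {α : Type*} (n : ℕ) (Γ : SimpleGraph α) (G : Type*) [Group G]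
    [MulAction G α] : Prop :=
  ∀ u : α, ∃ φ : Γ.neighborSet u ≃ Vec n,
    (∀ g ∈ stabilizer G u, ∃ l ∈ Lgrp n, ∀ z : Γ.neighborSet u,
      ∃ hz : (g • (z : α)) ∈ Γ.neighborSet u, φ ⟨g • (z : α), hz⟩ = l (φ z)) ∧
    (∀ l ∈ Lgrp n, ∃ g ∈ stabilizer G u, ∀ z : Γ.neighborSet u,
      ∃ hz : (g • (z : α)) ∈ Γ.neighborSet u, φ ⟨g • (z : α), hz⟩ = l (φ z))

/-- Every element of `L` is a map `v ↦ v + c` or `v ↦ -v + c`. -/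
theorem exists_affine_of_mem_Lgrp {n : ℕ} {l : Equiv.Perm (Vec n)} (hl : l ∈ Lgrp n) :
    ∃ c : Vec n, (∀ v, l v = v + c) ∨ (∀ v, l v = -v + c) := by
  induction hl using Subgroup.closure_induction with
  | mem f hf =>
    rcases hf with ⟨c, hc⟩ | hf
    · exact ⟨c, Or.inl hc⟩
    · rw [Set.mem_singleton_iff] at hf
      subst hf
      exact ⟨0, Or.inr fun v => by simp⟩
  | one => exact ⟨0, Or.inl fun v => by simp⟩
  | mul f g _ _ hf hg =>
    obtain ⟨c, hc⟩ := hf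
    obtain ⟨d, hd⟩ := hg
    rcases hc with hc | hc <;> rcases hd with hd | hd
    · exact ⟨d + c, Or.inl fun v => by rw [Equiv.Perm.mul_apply, hc, hd]; abel⟩
    · exact ⟨d + c, Or.inr fun v => by rw [Equiv.Perm.mul_apply, hc, hd]; abel⟩
    · exact ⟨-d + c, Or.inr fun v => by rw [Equiv.Perm.mul_apply, hc, hd]; abel⟩
    · exact ⟨-d + c, Or.inl fun v => by rw [Equiv.Perm.mul_apply, hc, hd]; abel⟩
  | inv f _ hf =>
    obtain ⟨c, hc | hc⟩ := hf
    · exact ⟨-c, Or.inl fun v => by rw [Equiv.Perm.inv_eq_iff_eq, hc]; abel⟩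
    · exact ⟨c, Or.inr fun v => by rw [Equiv.Perm.inv_eq_iff_eq, hc]; abel⟩

theorem Vec.neg_two_smul {n : ℕ} (v : Vec n) : -(v + v) = v := by
  ext i
  simp only [Pi.neg_apply, Pi.add_apply]
  generalize v i = a
  revert a
  decide

section LocalAction

variable {α : Type*} {n : ℕ} {Γ : SimpleGraph α} {G : Type*} [Group G] [MulAction G α]

/-- An element of an arc stabilizer squares to the identity on the neighbourhood. -/
theorem LocallyL.smul_smul_eq (hloc : LocallyL n Γ G) {g : G} {u w z : α} (hu : g • u = u)
    (huw : Γ.Adj u w) (hw : g • w = w) (huz : Γ.Adj u z) : g • g • z = z := by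
  obtain ⟨φ, h1, -⟩ := hloc u
  obtain ⟨l, hl, h⟩ := h1 g hu
  obtain ⟨c, hc⟩ := exists_affine_of_mem_Lgrp hl
  obtain ⟨hz, ez⟩ := h ⟨z, huz⟩
  obtain ⟨hz', ez'⟩ := h ⟨g • z, hz⟩
  obtain ⟨hw', ew⟩ := h ⟨w, huw⟩
  have e : (⟨g • w, hw'⟩ : Γ.neighborSet u) = ⟨w, huw⟩ := Subtype.ext hw
  simp only [e] at ew
  simp only at ez ez'
  suffices φ ⟨g • g • z, hz'⟩ = φ ⟨z, huz⟩ from congrArg Subtype.val (φ.injective this)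
  rw [ez', ez]
  rcases hc with hc | hc
  · rw [hc] at ew
    have : c = 0 := by simpa using ew
    simp [hc, this]
  · simp [hc]

/-- If `a` fixes the arc `(u, w)` and moves a neighbour of `u`, then every pair of neighbours of
`u` is mapped by some `G_u`-conjugate of `a`. -/
theorem LocallyL.exists_conj_smul_eq (hloc : LocallyL n Γ G) {a : G} {u w z : α}
    (hu : a • u = u) (huw : Γ.Adj u w) (hw : a • w = w) (huz : Γ.Adj u z) (hz : a • z ≠ z)
    {p p' : α} (hp : Γ.Adj u p) (hp' : Γ.Adj u p') :
    ∃ g : G, g • u = u ∧ (g * a * g⁻¹) • p = p' := by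
  obtain ⟨φ, h1, h2⟩ := hloc u
  obtain ⟨l, hl, h⟩ := h1 a hu
  obtain ⟨c, hc⟩ := exists_affine_of_mem_Lgrp hl
  have hc : ∀ v, l v = -v + c := by
    refine hc.resolve_left fun hc => hz ?_
    obtain ⟨hw', ew⟩ := h ⟨w, huw⟩
    have e : (⟨a • w, hw'⟩ : Γ.neighborSet u) = ⟨w, huw⟩ := Subtype.ext hw
    simp only [e] at ew
    rw [hc] at ew
    have hc0 : c = 0 := by simpa using ew
    obtain ⟨hz', ez⟩ := h ⟨z, huz⟩
    rw [hc, hc0, add_zero] at ez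
    exact congrArg Subtype.val (φ.injective ez)
  -- conjugating by a translation moves the centre of the inversion
  set d : Vec n := -(φ ⟨p, hp⟩ + φ ⟨p', hp'⟩ - c) with hd
  obtain ⟨g, hgu, hg⟩ := h2 (Equiv.addRight d)
    (Subgroup.subset_closure (Or.inl ⟨d, fun v => rfl⟩))
  refine ⟨g, hgu, ?_⟩
  replace hg : ∀ z : Γ.neighborSet u,
      ∃ hz : g • (z : α) ∈ Γ.neighborSet u, φ ⟨g • (z : α), hz⟩ = φ z + d := hg
  obtain ⟨r, hr⟩ := φ.surjective (φ ⟨p, hp⟩ - d)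
  obtain ⟨hr1, er⟩ := hg r
  have e1 : g • (r : α) = p := by
    rw [hr, sub_add_cancel] at er
    exact congrArg Subtype.val (φ.injective er)
  obtain ⟨hr2, er2⟩ := h r
  obtain ⟨hr3, er3⟩ := hg ⟨a • (r : α), hr2⟩
  have e2 : g • a • (r : α) = p' := by
    rw [er2, hc, hr] at er3
    refine congrArg Subtype.val (φ.injective (er3.trans ?_) : _ = (⟨p', hp'⟩ : Γ.neighborSet u))
    have := Vec.neg_two_smul (φ ⟨p, hp⟩ + φ ⟨p', hp'⟩ - c)
    have h3 : d + d = φ ⟨p, hp⟩ + φ ⟨p', hp'⟩ - c := by rw [hd, ← neg_add, this]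
    calc _ = -φ ⟨p, hp⟩ + c + (d + d) := by abel
      _ = _ := by rw [h3]; abel
  rw [mul_smul, mul_smul, ← e1, inv_smul_smul, e2]

end LocalAction

section Stabilizers

variable {α : Type*} {Γ : SimpleGraph α} {G : Type*} [Group G] [MulAction G α]

theorem mem_ballStab_one (hconn : Γ.Connected) {u : α} {g : G} :
    g ∈ ballStab Γ G u 1 ↔ g • u = u ∧ ∀ w, Γ.Adj u w → g • w = w := by
  simp only [ballStab, Subgroup.mem_iInf, Set.mem_ofPred_eq, mem_stabilizer_iff]
  constructor
  · exact fun h => ⟨h u (by simp), fun w hw => h w (SimpleGraph.dist_eq_one_iff_adj.2 hw).le⟩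
  · rintro ⟨h0, h1⟩ w hw
    rcases Nat.le_one_iff_eq_zero_or_eq_one.1 hw with hw | hw
    · rw [← hconn.dist_eq_zero_iff.1 hw, h0]
    · exact h1 w (SimpleGraph.dist_eq_one_iff_adj.1 hw)

theorem conj_mem_ballStab_one (hconn : Γ.Connected)
    (haut : ∀ (g : G) (u w : α), Γ.Adj u w ↔ Γ.Adj (g • u) (g • w)) {u v : α} {g q : G}
    (hg : g • u = v) (hq : q ∈ ballStab Γ G u 1) : g * q * g⁻¹ ∈ ballStab Γ G v 1 := by
  rw [mem_ballStab_one hconn] at hq ⊢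
  have hv : g⁻¹ • v = u := by rw [← hg, inv_smul_smul]
  refine ⟨by rw [mul_smul, mul_smul, hv, hq.1, hg], fun w hw => ?_⟩
  rw [mul_smul, mul_smul, hq.2 _ (by rw [← hv]; exact (haut _ _ _).1 hw), smul_inv_smul]

/-- The generators of `Z_{uw}`: central elements of order at most 2 of the arc stabilizer. -/
def IsArcCentralInvolution (u w : α) (z : G) : Prop :=
  z • u = u ∧ z • w = w ∧ (∀ g : G, g • u = u → g • w = w → g * z = z * g) ∧ z ^ 2 = 1

theorem Zuw_eq_closure (u w : α) :
    Zuw G u w = Subgroup.closure {z : G | IsArcCentralInvolution u w z} := by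
  unfold Zuw
  congr 1
  ext z
  simp only [Set.mem_ofPred_eq, Subgroup.mem_inf, mem_stabilizer_iff, Subgroup.mem_centralizer_iff,
    SetLike.mem_coe, IsArcCentralInvolution, and_imp, and_assoc]

theorem IsArcCentralInvolution.conj {u w u' w' : α} {z t : G} (hz : IsArcCentralInvolution u w z)
    (hu : t • u = u') (hw : t • w = w') : IsArcCentralInvolution u' w' (t * z * t⁻¹) := by
  obtain ⟨h1, h2, h3, h4⟩ := hz
  have hu' : t⁻¹ • u' = u := by rw [← hu, inv_smul_smul]
  have hw' : t⁻¹ • w' = w := by rw [← hw, inv_smul_smul]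
  refine ⟨by rw [mul_smul, mul_smul, hu', h1, hu], by rw [mul_smul, mul_smul, hw', h2, hw],
    fun g gu gw => ?_, by rw [conj_pow, h4]; simp⟩
  have := h3 (t⁻¹ * g * t) (by rw [mul_smul, mul_smul, hu, gu, hu'])
    (by rw [mul_smul, mul_smul, hw, gw, hw'])
  calc g * (t * z * t⁻¹) = t * ((t⁻¹ * g * t) * z) * t⁻¹ := by group
    _ = t * z * t⁻¹ * g := by rw [this]; group

theorem conj_mem_Zsub {u : α} {g z : G} (hg : g • u = u) (hz : z ∈ Zsub Γ G u) :
    g * z * g⁻¹ ∈ Zsub Γ G u := by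
  have : Zsub Γ G u ≤ (Zsub Γ G u).comap (MulAut.conj g).toMonoidHom := by
    conv_lhs => unfold Zsub
    rw [Subgroup.closure_le]
    rintro k ⟨h, hh, w, hw, z, hz, rfl⟩
    refine Subgroup.subset_closure ⟨g * h, mul_mem hg hh, w, hw, z, hz, ?_⟩
    simp [mul_assoc]
  exact this hz

theorem IsArcCentralInvolution.mem_Zsub {u w : α} {z : G} (huw : Γ.Adj u w)
    (hz : IsArcCentralInvolution u w z) : z ∈ Zsub Γ G u :=
  Subgroup.subset_closure ⟨1, one_mem _, w, huw, z,
    by rw [Zuw_eq_closure]; exact Subgroup.subset_closure hz, by simp⟩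

/-- `Z_u` centralizes `G_u^{[1]}`. -/
theorem commute_of_mem_Zsub (hconn : Γ.Connected)
    (haut : ∀ (g : G) (u w : α), Γ.Adj u w ↔ Γ.Adj (g • u) (g • w)) {u : α} {z q : G}
    (hz : z ∈ Zsub Γ G u) (hq : q ∈ ballStab Γ G u 1) : z * q = q * z := by
  have : Zsub Γ G u ≤ Subgroup.centralizer (ballStab Γ G u 1 : Set G) := by
    unfold Zsub
    rw [Subgroup.closure_le]
    rintro k ⟨h, hh, w, hw, z, hz, rfl⟩ q hq
    rw [mem_stabilizer_iff] at hh
    have h1 : h⁻¹ * q * h ∈ ballStab Γ G u 1 := by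
      simpa using conj_mem_ballStab_one hconn haut (inv_smul_eq_iff.2 hh.symm : h⁻¹ • u = u) hq
    rw [mem_ballStab_one hconn] at h1
    have h2 : Zuw G u w ≤ Subgroup.centralizer {h⁻¹ * q * h} := by
      rw [Zuw_eq_closure, Subgroup.closure_le]
      intro y hy
      rw [SetLike.mem_coe, Subgroup.mem_centralizer_singleton_iff]
      exact (hy.2.2.1 _ h1.1 (h1.2 w hw)).symm
    have h3 := Subgroup.mem_centralizer_singleton_iff.1 (h2 hz)
    calc q * (h * z * h⁻¹) = h * ((h⁻¹ * q * h) * z) * h⁻¹ := by group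
      _ = h * z * h⁻¹ * q := by rw [← h3]; group
  exact (this hz q hq).symm

/-- An element fixing the edge `{u, w}` whose centralizer is locally transitive at both ends
is trivial. -/
theorem eq_one_of_centralizer_transitive (hconn : Γ.Connected)
    (haut : ∀ (g : G) (u w : α), Γ.Adj u w ↔ Γ.Adj (g • u) (g • w))
    (hfaith : ∀ g : G, (∀ u : α, g • u = u) → g = 1) {u w : α} (huw : Γ.Adj u w) {q : G}
    (hqu : q • u = u) (hqw : q • w = w)
    (hu : ∀ p p', Γ.Adj u p → Γ.Adj u p' → ∃ k : G, k • u = u ∧ k * q = q * k ∧ k • p = p')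
    (hw : ∀ p p', Γ.Adj w p → Γ.Adj w p' → ∃ k : G, k • w = w ∧ k * q = q * k ∧ k • p = p') :
    q = 1 := by
  refine hfaith q fun p => ?_
  have key : ∃ h : G, h * q = q * h ∧ (h • p = u ∨ h • p = w) := by
    have := hconn.preconnected u p
    rw [SimpleGraph.reachable_iff_reflTransGen] at this
    induction this with
    | refl => exact ⟨1, by simp, by simp⟩
    | @tail b c _ hbc ih =>
      obtain ⟨h, hh, hb⟩ := ih
      have hadj := (haut h b c).1 hbc
      rcases hb with hb | hb <;> rw [hb] at hadj
      · obtain ⟨k, -, hkq, hk⟩ := hu _ _ hadj huw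
        exact ⟨k * h, by rw [mul_assoc, hh, ← mul_assoc, hkq, mul_assoc],
          Or.inr (by rw [mul_smul, hk])⟩
      · obtain ⟨k, -, hkq, hk⟩ := hw _ _ hadj huw.symm
        exact ⟨k * h, by rw [mul_assoc, hh, ← mul_assoc, hkq, mul_assoc],
          Or.inl (by rw [mul_smul, hk])⟩
  obtain ⟨h, hh, hp⟩ := key
  apply MulAction.injective h
  simp only
  rw [← mul_smul, hh, mul_smul]
  rcases hp with hp | hp <;> rw [hp] <;> assumption

/-- If the conjugates under `G_u` of an element `a` of an arc stabilizer acting nontrivially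
on `Γ(u)` commute with `q` and with its conjugate under an edge flip, then `q = 1`. -/
theorem eq_one_of_conj_commute {n : ℕ} (hconn : Γ.Connected)
    (haut : ∀ (g : G) (u w : α), Γ.Adj u w ↔ Γ.Adj (g • u) (g • w))
    (hfaith : ∀ g : G, (∀ u : α, g • u = u) → g = 1) (hloc : LocallyL n Γ G)
    {u w z : α} (huw : Γ.Adj u w) {a q t : G} (hau : a • u = u) (haw : a • w = w)
    (huz : Γ.Adj u z) (haz : a • z ≠ z) (htu : t • u = w)
    (hqu : q • u = u) (hqw : q • w = w)
    (h1 : ∀ g : G, g • u = u → (g * a * g⁻¹) * q = q * (g * a * g⁻¹))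
    (h2 : ∀ g : G, g • u = u →
      (g * a * g⁻¹) * (t⁻¹ * q * t) = (t⁻¹ * q * t) * (g * a * g⁻¹)) : q = 1 := by
  have hfix : ∀ g : G, g • u = u → (g * a * g⁻¹) • u = u := fun g hg => by
    rw [mul_smul, mul_smul, inv_smul_eq_iff.2 hg.symm, hau, hg]
  have htw : t⁻¹ • w = u := by rw [← htu, inv_smul_smul]
  refine eq_one_of_centralizer_transitive hconn haut hfaith huw hqu hqw ?_ ?_
  · intro p p' hp hp'
    obtain ⟨g, hg, hgp⟩ := hloc.exists_conj_smul_eq hau huw haw huz haz hp hp'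
    exact ⟨_, hfix g hg, h1 g hg, hgp⟩
  · intro p p' hp hp'
    rw [haut t⁻¹, htw] at hp hp'
    obtain ⟨g, hg, hgp⟩ := hloc.exists_conj_smul_eq hau huw haw huz haz hp hp'
    have h2' := h2 g hg
    have h3 := hfix g hg
    generalize g * a * g⁻¹ = k at h2' h3 hgp
    refine ⟨t * k * t⁻¹, by rw [mul_smul, mul_smul, htw, h3, htu], ?_, ?_⟩
    · calc t * k * t⁻¹ * q = t * (k * (t⁻¹ * q * t)) * t⁻¹ := by group
        _ = q * (t * k * t⁻¹) := by rw [h2']; group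
    · rw [mul_smul, mul_smul, hgp, smul_inv_smul]

/-- An element of odd order fixing an arc is trivial. -/
theorem eq_one_of_odd_pow_eq_one {n : ℕ} (hconn : Γ.Connected)
    (hfaith : ∀ g : G, (∀ u : α, g • u = u) → g = 1) (hloc : LocallyL n Γ G)
    {u w : α} (huw : Γ.Adj u w) {h : G} {m : ℕ} (hm : Odd m) (hh : h ^ m = 1)
    (hu : h • u = u) (hw : h • w = w) : h = 1 := by
  have step : ∀ a b : α, Γ.Adj a b → h • a = a → h • b = b → ∀ c, Γ.Adj a c → h • c = c := by
    intro a b hab ha hb c hac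
    have h2 : h ^ 2 ∈ stabilizer G c := by
      rw [mem_stabilizer_iff, pow_two, mul_smul]
      exact hloc.smul_smul_eq ha hab hb hac
    obtain ⟨k, rfl⟩ := hm
    have h3 : (h ^ 2) ^ k * h ∈ stabilizer G c := by
      rw [← pow_mul, ← pow_succ, hh]; exact one_mem _
    exact (Subgroup.mul_mem_cancel_left _ (pow_mem h2 k)).1 h3
  refine hfaith h fun p => ?_
  suffices h • p = p ∧ ∃ b, Γ.Adj p b ∧ h • b = b from this.1
  have := hconn.preconnected u p
  rw [SimpleGraph.reachable_iff_reflTransGen] at this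
  induction this with
  | refl => exact ⟨hu, w, huw, hw⟩
  | @tail b c _ hbc ih =>
    obtain ⟨hb, d, hd, hd'⟩ := ih
    exact ⟨step b d hd hb hd' c hbc, b, hbc.symm, hb⟩

/-- A nontrivial arc stabilizer has a central involution. -/
theorem exists_isArcCentralInvolution_ne_one {n : ℕ} (hconn : Γ.Connected)
    (hfaith : ∀ g : G, (∀ u : α, g • u = u) → g = 1) (hloc : LocallyL n Γ G)
    {u w : α} (hfin : Finite (stabilizer G u)) (huw : Γ.Adj u w) {q : G} (hq : q ≠ 1)
    (hqu : q • u = u) (hqw : q • w = w) : ∃ z : G, IsArcCentralInvolution u w z ∧ z ≠ 1 := by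
  set H : Subgroup G := stabilizer G u ⊓ stabilizer G w
  have : Finite H := Finite.of_injective (Subgroup.inclusion inf_le_left)
    (Subgroup.inclusion_injective (inf_le_left : H ≤ stabilizer G u))
  have : Nontrivial H := ⟨⟨⟨q, hqu, hqw⟩, 1, fun h => hq (congrArg Subtype.val h)⟩⟩
  have hp : IsPGroup 2 H := by
    rintro ⟨g, hg⟩
    obtain ⟨hgu, hgw⟩ := Subgroup.mem_inf.1 hg
    have hpos : orderOf g ≠ 0 := by
      have := (isOfFinOrder_of_finite (⟨g, hg⟩ : H)).orderOf_pos
      rw [Subgroup.orderOf_mk] at this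
      exact this.ne'
    obtain ⟨k, m, hm, hkm⟩ := Nat.exists_eq_two_pow_mul_odd hpos
    refine ⟨k, Subtype.ext ?_⟩
    refine eq_one_of_odd_pow_eq_one hconn hfaith hloc huw hm ?_
      (pow_mem hgu _ : _ ∈ stabilizer G u) (pow_mem hgw _ : _ ∈ stabilizer G w)
    rw [SubmonoidClass.mk_pow, ← pow_mul, ← hkm, pow_orderOf_eq_one]
  have : Nontrivial (Subgroup.center H) := hp.center_nontrivial
  have hd : 2 ∣ Nat.card (Subgroup.center H) := by
    obtain ⟨k, hk, hk'⟩ := (hp.to_subgroup (Subgroup.center H)).nontrivial_iff_card.1 this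
    rw [hk']
    exact dvd_pow_self 2 hk.ne'
  obtain ⟨z, hz⟩ := exists_prime_orderOf_dvd_card' 2 hd
  refine ⟨z, ⟨z.1.2.1, z.1.2.2, fun g hgu hgw => ?_, ?_⟩, ?_⟩
  · exact congrArg Subtype.val (Subgroup.mem_center_iff.1 z.2 ⟨g, hgu, hgw⟩)
  · have : z ^ 2 = 1 := by rw [← hz, pow_orderOf_eq_one]
    exact congrArg (fun y : Subgroup.center H => (y : H).1) this
  · intro h
    have : z = 1 := Subtype.ext (Subtype.ext h)
    simp [this] at hz

/-- `Z_u ≤ G_u^{[1]}` when the edge kernels are nontrivial. -/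
theorem Zsub_le_ballStab_one {n : ℕ} (hconn : Γ.Connected)
    (haut : ∀ (g : G) (u w : α), Γ.Adj u w ↔ Γ.Adj (g • u) (g • w))
    (hfaith : ∀ g : G, (∀ u : α, g • u = u) → g = 1)
    (harc : ∀ u w u' w' : α, Γ.Adj u w → Γ.Adj u' w' → ∃ g : G, g • u = u' ∧ g • w = w')
    (hloc : LocallyL n Γ G)
    (hker : ∀ u w, Γ.Adj u w → ∃ q ∈ ballStab Γ G u 1 ⊓ ballStab Γ G w 1, q ≠ 1) (u : α) :
    Zsub Γ G u ≤ ballStab Γ G u 1 := by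
  unfold Zsub
  rw [Subgroup.closure_le]
  rintro k ⟨h, hh, w, huw, z, hz, rfl⟩
  refine conj_mem_ballStab_one hconn haut hh ?_
  clear hh h
  rw [SimpleGraph.mem_neighborSet] at huw
  revert z
  change Zuw G u w ≤ _
  rw [Zuw_eq_closure, Subgroup.closure_le]
  intro z hz
  rw [SetLike.mem_coe, mem_ballStab_one hconn]
  refine ⟨hz.1, fun p hp => ?_⟩
  by_contra hne
  obtain ⟨t, htu, htw⟩ := harc u w w u huw huw.symm
  obtain ⟨q, ⟨hqu, hqw⟩, hq1⟩ := hker u w huw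
  have comm : ∀ q ∈ ballStab Γ G u 1, ∀ g : G, g • u = u →
      (g * z * g⁻¹) * q = q * (g * z * g⁻¹) := fun q hq g hg =>
    commute_of_mem_Zsub hconn haut (conj_mem_Zsub hg (hz.mem_Zsub huw)) hq
  have hq' : t⁻¹ * q * t ∈ ballStab Γ G u 1 := by
    simpa using conj_mem_ballStab_one hconn haut (inv_smul_eq_iff.2 htu.symm : t⁻¹ • w = u) hqw
  exact hq1 (eq_one_of_conj_commute hconn haut hfaith hloc huw hz.1 hz.2.1 hp hne htu
    ((mem_ballStab_one hconn).1 hqu).1 ((mem_ballStab_one hconn).1 hqw).1 (comm q hqu)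
    (comm _ hq'))

end Stabilizers

/-- if `(u,v)` is a critical pair then so is `(v,u)`. -/
theorem critPair_symm
    {α : Type*} (n : ℕ) (hn : 2 ≤ n) (Γ : SimpleGraph α)
    (G : Type*) [Group G] [MulAction G α]
    (hconn : Γ.Connected) (hacyc : Γ.IsAcyclic)
    (haut : ∀ (g : G) (u w : α), Γ.Adj u w ↔ Γ.Adj (g • u) (g • w))
    (hfaith : ∀ g : G, (∀ u : α, g • u = u) → g = 1)
    (harc : ∀ u w u' w' : α, Γ.Adj u w → Γ.Adj u' w' → ∃ g : G, g • u = u' ∧ g • w = w')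
    (hfin : ∀ u : α, Finite (stabilizer G u))
    (hloc : LocallyL n Γ G)
    (x y : α) (hxy : Γ.Adj x y)
    (hntriv : ballStab Γ G x 1 ⊓ ballStab Γ G y 1 ≠ ⊥)
    (u v : α) (huv : critPair Γ G u v) :
    critPair Γ G v u := by
  have hker : ∀ u w, Γ.Adj u w → ∃ q ∈ ballStab Γ G u 1 ⊓ ballStab Γ G w 1, q ≠ 1 := by
    intro u w huw
    obtain ⟨q, hq, hq1⟩ := (Subgroup.bot_or_exists_ne_one _).resolve_left hntriv
    obtain ⟨g, hgu, hgw⟩ := harc x y u w hxy huw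
    exact ⟨g * q * g⁻¹, ⟨conj_mem_ballStab_one hconn haut hgu hq.1,
      conj_mem_ballStab_one hconn haut hgw hq.2⟩, by simpa using hq1⟩
  have hZ := Zsub_le_ballStab_one hconn haut hfaith harc hloc hker
  obtain ⟨hd, hnle⟩ := huv
  refine ⟨by rw [SimpleGraph.dist_comm, hd], fun hle => ?_⟩
  have hne : v ≠ u := by
    rintro rfl
    exact hnle (hZ v)
  obtain ⟨w, hvw, hw⟩ : ∃ w, Γ.Adj v w ∧ Γ.dist u v = Γ.dist u w + 1 := by
    obtain ⟨P, hP⟩ := hconn.exists_walk_length_eq_dist v u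
    cases P with
    | nil => exact absurd rfl hne
    | @cons _ w _ hvw P =>
      refine ⟨w, hvw, ?_⟩
      have h1 : Γ.dist w u ≤ P.length := SimpleGraph.dist_le P
      have h2 : Γ.dist v u ≤ Γ.dist v w + Γ.dist w u := hconn.dist_triangle
      rw [SimpleGraph.dist_eq_one_iff_adj.2 hvw] at h2
      rw [SimpleGraph.Walk.length_cons] at hP
      rw [SimpleGraph.dist_comm, SimpleGraph.dist_comm (u := u)]
      omega
  have hZw : Zsub Γ G u ≤ ballStab Γ G w 1 := by
    by_contra hcon
    have : critDist Γ G ≤ Γ.dist u w := Nat.sInf_le ⟨u, w, rfl, hcon⟩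
    omega
  obtain ⟨a, ha, hav⟩ := SetLike.not_le_iff_exists.1 hnle
  have haw := (mem_ballStab_one hconn).1 (hZw ha)
  rw [mem_ballStab_one hconn] at hav
  have hav' : a • v = v := haw.2 v hvw.symm
  obtain ⟨p, hp, hap⟩ : ∃ p, Γ.Adj v p ∧ a • p ≠ p := by
    by_contra! hcon
    exact hav ⟨hav', hcon⟩
  obtain ⟨q, ⟨hqv, hqw⟩, hq1⟩ := hker v w hvw
  obtain ⟨z, hz, hz1⟩ := exists_isArcCentralInvolution_ne_one hconn hfaith hloc (hfin v) hvw hq1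
    ((mem_ballStab_one hconn).1 hqv).1 ((mem_ballStab_one hconn).1 hqw).1
  obtain ⟨t, htv, htw⟩ := harc v w w v hvw hvw.symm
  have comm : ∀ z ∈ Zsub Γ G v, ∀ g : G, g • v = v →
      (g * a * g⁻¹) * z = z * (g * a * g⁻¹) := by
    intro z hz g hg
    have h1 : g⁻¹ * z * g ∈ Zsub Γ G v := by
      simpa using conj_mem_Zsub (inv_smul_eq_iff.2 hg.symm : g⁻¹ • v = v) hz
    have h2 := commute_of_mem_Zsub hconn haut ha (hle h1)
    calc g * a * g⁻¹ * z = g * (a * (g⁻¹ * z * g)) * g⁻¹ := by group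
      _ = z * (g * a * g⁻¹) := by rw [h2]; group
  have hz' : IsArcCentralInvolution v w (t⁻¹ * z * t) := by
    have := hz.conj (inv_smul_eq_iff.2 htw.symm : t⁻¹ • v = w)
      (inv_smul_eq_iff.2 htv.symm : t⁻¹ • w = v)
    rw [inv_inv] at this
    exact ⟨this.2.1, this.1, fun g h1 h2 => this.2.2.1 g h2 h1, this.2.2.2⟩
  exact hz1 (eq_one_of_conj_commute hconn haut hfaith hloc hvw hav' haw.1 hp hap htv hz.1 hz.2.1
    (comm z (hz.mem_Zsub hvw)) (comm _ (hz'.mem_Zsub hvw)))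
end

section
/- The critical distance satisfies b ≤ 2. -/
open MulAction Pointwise

section LocalInversions

variable {α : Type*} {Γ : SimpleGraph α} {G : Type*} [Group G] [MulAction G α]

/-- `g` fixes `u` and its neighbour `p`, but acts nontrivially on the neighbourhood of `u`. -/
def IsLocalInv (Γ : SimpleGraph α) (u p : α) (g : G) : Prop :=
  g • u = u ∧ g • p = p ∧ g ∉ ballStab Γ G u 1

/-- An arc-transitive faithful action on a connected graph with finite arc stabilizers in which
the local action at each vertex behaves like the inversions of an elementary abelian `3`-group. -/
structure LocallyInversive (Γ : SimpleGraph α) (G : Type*) [Group G] [MulAction G α] : Prop where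
  conn : Γ.Connected
  adj_smul : ∀ (g : G) {u w : α}, Γ.Adj u w → Γ.Adj (g • u) (g • w)
  faithful : ∀ g : G, (∀ u : α, g • u = u) → g = 1
  arc : ∀ {u w u' w' : α}, Γ.Adj u w → Γ.Adj u' w' → ∃ g : G, g • u = u' ∧ g • w = w'
  fin : ∀ u : α, Finite (stabilizer G u)
  inv_exists : ∀ {u p : α}, Γ.Adj u p → ∃ g : G, IsLocalInv Γ u p g
  inv_comm : ∀ {u p q : α} {s t : G}, Γ.Adj u p → Γ.Adj u q → IsLocalInv Γ u p s →
    IsLocalInv Γ u q t → s • q = t • p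
  inv_inv : ∀ {u p q : α} {s t : G}, Γ.Adj u p → Γ.Adj u q → IsLocalInv Γ u p s →
    IsLocalInv Γ u p t → s • t • q = q

theorem smul_inv_fix {g : G} {u : α} (h : g • u = u) : g⁻¹ • u = u := by
  rw [inv_smul_eq_iff, h]

theorem conj_smul_fix {g x : G} {u : α} (h : x • u = u) : (g * x * g⁻¹) • g • u = g • u := by
  simp [mul_smul, h]

theorem mem_Zuw {u w : α} {x : G} : x ∈ Zuw G u w ↔ x • u = u ∧ x • w = w ∧
    (∀ h : G, h • u = u → h • w = w → h * x = x * h) ∧ x ^ 2 = 1 := by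
  constructor
  · intro hx
    refine Subgroup.closure_induction (p := fun x _ => x • u = u ∧ x • w = w ∧
      (∀ h : G, h • u = u → h • w = w → h * x = x * h) ∧ x ^ 2 = 1) ?_ ?_ ?_ ?_ hx
    · rintro x ⟨⟨⟨h1, h2⟩, h3⟩, h4⟩
      refine ⟨h1, h2, fun h hu hw => ?_, h4⟩
      exact Subgroup.mem_centralizer_iff.1 h3 h ⟨hu, hw⟩
    · simp
    · rintro x y - - ⟨a1, a2, a3, a4⟩ ⟨b1, b2, b3, b4⟩
      refine ⟨by rw [mul_smul, b1, a1], by rw [mul_smul, b2, a2], fun h hu hw => ?_, ?_⟩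
      · rw [← mul_assoc, a3 h hu hw, mul_assoc, b3 h hu hw, mul_assoc]
      · have hc : Commute x y := b3 x a1 a2
        rw [hc.mul_pow, a4, b4, one_mul]
    · rintro x - ⟨a1, a2, a3, a4⟩
      refine ⟨smul_inv_fix a1, smul_inv_fix a2, fun h hu hw => ?_, ?_⟩
      · have hc : Commute h x := a3 h hu hw
        exact hc.inv_right
      · rw [inv_pow, a4, inv_one]
  · rintro ⟨h1, h2, h3, h4⟩
    refine Subgroup.subset_closure ⟨⟨⟨h1, h2⟩, ?_⟩, h4⟩
    exact Subgroup.mem_centralizer_iff.2 fun h hh => h3 h hh.1 hh.2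

theorem Zuw_comm (u w : α) : Zuw G u w = Zuw G w u := by
  ext x
  simp only [mem_Zuw]
  constructor <;> exact fun ⟨a, b, c, d⟩ => ⟨b, a, fun h hu hw => c h hw hu, d⟩

theorem conj_mem_Zuw {u w : α} {x : G} (g : G) (hx : x ∈ Zuw G u w) :
    g * x * g⁻¹ ∈ Zuw G (g • u) (g • w) := by
  rw [mem_Zuw] at hx ⊢
  obtain ⟨a, b, c, d⟩ := hx
  refine ⟨conj_smul_fix a, conj_smul_fix b, fun h hu hw => ?_, by rw [conj_pow, d]; simp⟩
  have := c (g⁻¹ * h * g) (by simp [mul_smul, hu]) (by simp [mul_smul, hw])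
  calc h * (g * x * g⁻¹) = g * (g⁻¹ * h * g * x) * g⁻¹ := by group
    _ = g * x * g⁻¹ * h := by rw [this]; group

theorem Zuw_le_Zsub {u w : α} (h : Γ.Adj u w) : Zuw G u w ≤ Zsub Γ G u := fun x hx =>
  Subgroup.subset_closure ⟨1, one_mem _, w, h, x, hx, by simp⟩

theorem mem_ball_or_isLocalInv {g : G} {u p : α} (hu : g • u = u) (hp : g • p = p) :
    g ∈ ballStab Γ G u 1 ∨ IsLocalInv Γ u p g := by
  by_cases h : g ∈ ballStab Γ G u 1
  · exact Or.inl h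
  · exact Or.inr ⟨hu, hp, h⟩

theorem IsLocalInv.inv {u p : α} {s : G} (hs : IsLocalInv Γ u p s) : IsLocalInv Γ u p s⁻¹ :=
  ⟨smul_inv_fix hs.1, smul_inv_fix hs.2.1, fun h => hs.2.2 (by simpa using inv_mem h)⟩

theorem conj_mem_Zuw_of_fix {u p : α} {x g : G} (hg : g • u = u) (hx : x ∈ Zuw G u p) :
    g * x * g⁻¹ ∈ Zuw G u (g • p) := by
  have := conj_mem_Zuw g hx
  rwa [hg] at this

theorem conj_eq_of_commute {g x : G} (h : Commute g x) : g * x * g⁻¹ = x := by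
  rw [h.eq, mul_inv_cancel_right]

theorem commute_of_mem_Zuw {u p : α} {g x : G} (hx : x ∈ Zuw G u p) (hu : g • u = u)
    (hp : g • p = p) : Commute g x := (mem_Zuw.1 hx).2.2.1 g hu hp

namespace LocallyInversive

variable (S : LocallyInversive Γ G)
include S

theorem conj_mem_ball {u : α} {x : G} (g : G) (hx : x ∈ ballStab Γ G u 1) :
    g * x * g⁻¹ ∈ ballStab Γ G (g • u) 1 := by
  rw [mem_ballStab_one S.conn] at hx ⊢
  refine ⟨conj_smul_fix hx.1, fun w hw => ?_⟩
  have h1 := S.adj_smul g⁻¹ hw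
  rw [inv_smul_smul] at h1
  have h2 := conj_smul_fix (g := g) (hx.2 _ h1)
  rwa [smul_inv_smul] at h2

theorem adj_of_fix {g : G} {u p : α} (hg : g • u = u) (h : Γ.Adj u p) : Γ.Adj u (g • p) := by
  have := S.adj_smul g h
  rwa [hg] at this

theorem inv_mul_mem {u p : α} {s t : G} (hp : Γ.Adj u p) (hs : IsLocalInv Γ u p s)
    (ht : IsLocalInv Γ u p t) : s * t ∈ ballStab Γ G u 1 := by
  rw [mem_ballStab_one S.conn]
  refine ⟨by rw [mul_smul, ht.1, hs.1], fun w hw => ?_⟩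
  rw [mul_smul, S.inv_inv hp hw hs ht]

theorem conj_isLocalInv {u p : α} {s : G} (g : G) (hs : IsLocalInv Γ u p s) :
    IsLocalInv Γ (g • u) (g • p) (g * s * g⁻¹) := by
  refine ⟨conj_smul_fix hs.1, conj_smul_fix hs.2.1, fun h => hs.2.2 ?_⟩
  have := S.conj_mem_ball g⁻¹ h
  rw [inv_smul_smul] at this
  convert this using 1
  group

theorem exists_inv_swap {u i j : α} (hi : Γ.Adj u i) (hj : Γ.Adj u j) :
    ∃ d : α, ∃ t : G, Γ.Adj u d ∧ IsLocalInv Γ u d t ∧ t • j = i ∧ t • i = j := by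
  obtain ⟨s, hs⟩ := S.inv_exists hj
  have hd := S.adj_of_fix hs.1 hi
  obtain ⟨t, ht⟩ := S.inv_exists hd
  have h1 : t • j = i := by
    rw [← S.inv_comm hj hd hs ht, S.inv_inv hj hi hs hs]
  refine ⟨_, t, hd, ht, h1, ?_⟩
  rw [← h1, S.inv_inv hd hj ht ht]

theorem spread {P : α → Prop} {a b : α} (ha : P a) (hb : P b) (hab : Γ.Adj a b)
    (step : ∀ a b c, P a → P b → Γ.Adj a b → Γ.Adj a c → P c) (v : α) : P v := by
  obtain ⟨w⟩ := S.conn.preconnected a v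
  induction w generalizing b with
  | nil => exact ha
  | cons h p ih => exact ih (step _ _ _ ha hb hab h) ha h.symm

theorem eq_one_of_invariant {u w : α} (h : Γ.Adj u w) (N : Set G) (hu : ∀ x ∈ N, x • u = u)
    (hw : ∀ x ∈ N, x • w = w) (nu : ∀ g : G, g • u = u → ∀ x ∈ N, g * x * g⁻¹ ∈ N)
    (nw : ∀ g : G, g • w = w → ∀ x ∈ N, g * x * g⁻¹ ∈ N) : ∀ x ∈ N, x = 1 := by
  have key : ∀ v : α, (∀ x ∈ N, x • v = v) ∧ ∀ g : G, g • v = v → ∀ x ∈ N, g * x * g⁻¹ ∈ N := by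
    refine S.spread ⟨hu, nu⟩ ⟨hw, nw⟩ h ?_
    rintro a b c ⟨ha, na⟩ ⟨hb, nb⟩ hab hac
    obtain ⟨g, hga, rfl⟩ := S.arc hab hac
    have hc : ∀ x ∈ N, g⁻¹ * x * g ∈ N := fun x hx => by
      simpa using na g⁻¹ (smul_inv_fix hga) x hx
    constructor
    · intro x hx
      have := hb _ (hc x hx)
      rwa [mul_smul, mul_smul, inv_smul_eq_iff] at this
    · intro k hk x hx
      have h1 := nb (g⁻¹ * k * g) (by simp [mul_smul, hk]) _ (hc x hx)
      have h2 := na g hga _ h1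
      convert h2 using 1
      group
  exact fun x hx => S.faithful x fun v => (key v).1 x hx

theorem eq_one_of_swap {u w : α} (h : Γ.Adj u w) (N : Set G) (hu : ∀ x ∈ N, x • u = u)
    (hw : ∀ x ∈ N, x • w = w) (nu : ∀ g : G, g • u = u → ∀ x ∈ N, g * x * g⁻¹ ∈ N)
    (sw : ∀ g : G, g • u = w → g • w = u → ∀ x ∈ N, g * x * g⁻¹ ∈ N) : ∀ x ∈ N, x = 1 := by
  refine S.eq_one_of_invariant h N hu hw nu fun k hk x hx => ?_
  obtain ⟨g, h1, h2⟩ := S.arc h h.symm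
  have h3 : g⁻¹ • u = w := by rw [inv_smul_eq_iff, h2]
  have h4 : g⁻¹ • w = u := by rw [inv_smul_eq_iff, h1]
  have := sw g h1 h2 _ (nu (g⁻¹ * k * g) (by simp [mul_smul, h1, hk, h4]) _ (sw g⁻¹ h3 h4 x hx))
  convert this using 1
  group

theorem eq_one_of_odd_pow {a b : α} (hab : Γ.Adj a b) {g : G} (ha : g • a = a) (hb : g • b = b)
    {m : ℕ} (hm : Odd m) (h : g ^ m = 1) : g = 1 := by
  refine S.faithful g (S.spread (P := fun c => g • c = c) ha hb hab fun a b c ha hb hab hac => ?_)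
  rcases mem_ball_or_isLocalInv (Γ := Γ) ha hb with h1 | h1
  · exact ((mem_ballStab_one S.conn).1 h1).2 c hac
  · obtain ⟨j, rfl⟩ := hm
    have h2 : g ^ 2 ∈ stabilizer G c := by
      rw [mem_stabilizer_iff, pow_two, mul_smul, S.inv_inv hab hac h1 h1]
    have h3 : (g ^ 2) ^ j * g = 1 := by rw [← pow_mul, ← pow_succ, h]
    have h4 : g = ((g ^ 2) ^ j)⁻¹ := eq_inv_of_mul_eq_one_right h3
    have h5 : g ∈ stabilizer G c := h4 ▸ inv_mem (pow_mem h2 j)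
    exact h5

theorem isPGroup_arc {u w : α} (h : Γ.Adj u w) :
    IsPGroup 2 (stabilizer G u ⊓ stabilizer G w : Subgroup G) := by
  rintro ⟨g, hg⟩
  have := S.fin u
  have hfin : IsOfFinOrder g := by
    have := isOfFinOrder_of_finite (⟨g, hg.1⟩ : stabilizer G u)
    simpa using (Subgroup.subtype_injective (stabilizer G u)).isOfFinOrder_iff.2 this
  obtain ⟨k, m, hm, hk⟩ := Nat.exists_eq_two_pow_mul_odd hfin.orderOf_pos.ne'
  refine ⟨k, Subtype.ext ?_⟩
  have hmem := pow_mem hg (2 ^ k)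
  exact S.eq_one_of_odd_pow (g := g ^ 2 ^ k) h hmem.1 hmem.2 hm (by rw [← pow_mul, ← hk, pow_orderOf_eq_one])

theorem exists_ne_one_mem_Zuw {u w : α} (h : Γ.Adj u w) : ∃ x ∈ Zuw G u w, x ≠ 1 := by
  let H : Subgroup G := stabilizer G u ⊓ stabilizer G w
  have hfin : Finite H := by
    have := S.fin u
    exact Finite.of_injective _ (Subgroup.inclusion_injective (inf_le_left : H ≤ stabilizer G u))
  have hp : IsPGroup 2 H := S.isPGroup_arc h
  obtain ⟨s, hs⟩ := S.inv_exists h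
  have hs1 : s ≠ 1 := fun h1 => hs.2.2 (h1 ▸ one_mem _)
  have : Nontrivial H := ⟨⟨s, hs.1, hs.2.1⟩, 1, fun h1 => hs1 (congrArg Subtype.val h1)⟩
  have hc : Nontrivial (Subgroup.center H) := hp.center_nontrivial
  have hcp : IsPGroup 2 (Subgroup.center H) := hp.to_subgroup _
  obtain ⟨n, hn, hcard⟩ := hcp.nontrivial_iff_card.1 hc
  obtain ⟨c, hc2⟩ := exists_prime_orderOf_dvd_card' (G := Subgroup.center H) 2
    (hcard ▸ dvd_pow_self 2 hn.ne')
  have hcc := c.2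
  rw [Subgroup.mem_center_iff] at hcc
  have h2 : ((c : H) : G) ^ 2 = 1 := by
    have := pow_orderOf_eq_one c
    rw [hc2] at this
    simpa using congrArg (fun z : Subgroup.center H => ((z : H) : G)) this
  refine ⟨c, mem_Zuw.2 ⟨c.1.2.1, c.1.2.2, fun k hu hw => ?_, h2⟩, fun h1 => ?_⟩
  · exact congrArg Subtype.val (hcc ⟨k, hu, hw⟩)
  · have : c = 1 := Subtype.ext (Subtype.ext h1)
    rw [this, orderOf_one] at hc2
    omega

theorem Zsub_induction {u : α} {P : G → Prop}
    (base : ∀ w, Γ.Adj u w → ∀ x ∈ Zuw G u w, P x) (one : P 1)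
    (mul : ∀ x y, x ∈ Zsub Γ G u → y ∈ Zsub Γ G u → P x → P y → P (x * y))
    (inv : ∀ x, P x → P x⁻¹) {z : G} (hz : z ∈ Zsub Γ G u) : P z := by
  refine Subgroup.closure_induction (p := fun x _ => P x) ?_ one (fun x y hx hy => mul x y hx hy)
    (fun x _ => inv x) hz
  rintro k ⟨h, hh, w, hw, g, hg, rfl⟩
  rw [mem_stabilizer_iff] at hh
  have := conj_mem_Zuw h hg
  rw [hh] at this
  exact base _ (S.adj_of_fix hh hw) _ this

theorem conj_mem_Zsub {u : α} {x : G} (g : G) (hx : x ∈ Zsub Γ G u) :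
    g * x * g⁻¹ ∈ Zsub Γ G (g • u) := by
  refine S.Zsub_induction (P := fun x => g * x * g⁻¹ ∈ Zsub Γ G (g • u)) ?_ (by simp) ?_ ?_ hx
  · exact fun w hw x hx => Zuw_le_Zsub (S.adj_smul g hw) (conj_mem_Zuw g hx)
  · intro x y _ _ hx hy
    convert mul_mem hx hy using 1
    group
  · intro x hx
    convert inv_mem hx using 1
    group

theorem conj_mem_Zsub_of_fix {u : α} {x g : G} (hg : g • u = u) (hx : x ∈ Zsub Γ G u) :
    g * x * g⁻¹ ∈ Zsub Γ G u := by
  have := S.conj_mem_Zsub g hx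
  rwa [hg] at this

theorem commute_of_mem_ball {u : α} {z q : G} (hz : z ∈ Zsub Γ G u)
    (hq : q ∈ ballStab Γ G u 1) : Commute q z := by
  rw [mem_ballStab_one S.conn] at hq
  refine S.Zsub_induction (P := fun z => Commute q z) ?_ (Commute.one_right q)
    (fun x y _ _ => Commute.mul_right) (fun x => Commute.inv_right) hz
  exact fun w hw x hx => (mem_Zuw.1 hx).2.2.1 q hq.1 (hq.2 w hw)

theorem not_commute_Zsub {u p : α} {t : G} (hp : Γ.Adj u p) (ht : IsLocalInv Γ u p t) :
    ¬ ∀ z ∈ Zsub Γ G u, Commute t z := by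
  intro hc
  have hall : ∀ g : G, g • u = u → ∀ z ∈ Zsub Γ G u, Commute g z := by
    intro g hg z hz
    obtain ⟨d, s, hd, hs, h1, -⟩ := S.exists_inv_swap hp (S.adj_of_fix hg hp)
    obtain ⟨h, hu, rfl⟩ := S.arc hp hd
    have hct : Commute (h * t * h⁻¹) z := by
      have h2 := hc _ (S.conj_mem_Zsub_of_fix (smul_inv_fix hu) hz)
      have h3 : t * (h⁻¹ * z * h) = h⁻¹ * z * h * t := by simpa using h2.eq
      calc h * t * h⁻¹ * z = h * (t * (h⁻¹ * z * h)) * h⁻¹ := by group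
        _ = z * (h * t * h⁻¹) := by rw [h3]; group
    have hti := S.conj_isLocalInv h ht
    rw [hu] at hti
    have hg' := S.adj_of_fix hg hp
    have h4 : (h * t * h⁻¹) • g • p = p := by
      refine Eq.trans ?_ h1
      have h5 := S.inv_inv hd hg' hs.inv hs
      have h6 := S.inv_inv hd hg' hs.inv hti
      rw [inv_smul_eq_iff] at h6
      exact h6
    have h7 : Commute (h * t * h⁻¹ * g) z := by
      rcases mem_ball_or_isLocalInv (Γ := Γ) (g := h * t * h⁻¹ * g) (u := u) (p := p)
        (by rw [mul_smul, hg, hti.1]) (by rw [mul_smul, h4]) with h8 | h8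
      · exact S.commute_of_mem_ball hz h8
      · have h9 := S.commute_of_mem_ball hz (S.inv_mul_mem hp ht h8)
        have h10 := (hc z hz).inv_left.mul_left h9
        rwa [inv_mul_cancel_left] at h10
    have h11 := hct.inv_left.mul_left h7
    rwa [inv_mul_cancel_left] at h11
  obtain ⟨x, hx, hx1⟩ := S.exists_ne_one_mem_Zuw hp
  refine hx1 (S.eq_one_of_swap hp (Zuw G u p : Set G) (fun x hx => (mem_Zuw.1 hx).1)
    (fun x hx => (mem_Zuw.1 hx).2.1) ?_ ?_ x hx)
  · intro g hg y hy
    have h1 := hall g hg y (Zuw_le_Zsub hp hy)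
    have h2 : g * y * g⁻¹ = y := by rw [h1.eq, mul_inv_cancel_right]
    rwa [h2]
  · intro g h1 h2 y hy
    have h3 := conj_mem_Zuw g hy
    rw [h1, h2, Zuw_comm] at h3
    exact h3

theorem Zuw_eq_of_le {u p q : α} (hp : Γ.Adj u p) (hq : Γ.Adj u q)
    (h : Zuw G u p ≤ Zuw G u q) : Zuw G u p = Zuw G u q := by
  refine le_antisymm h fun x hx => ?_
  obtain ⟨d, t, hd, ht, h1, h2⟩ := S.exists_inv_swap hp hq
  have h3 := conj_mem_Zuw_of_fix (smul_inv_fix ht.1) hx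
  rw [inv_smul_eq_iff.2 h2.symm] at h3
  have h4 := conj_mem_Zuw_of_fix ht.1 (h h3)
  rw [h1] at h4
  convert h4 using 1
  group

variable (hZ : ∀ u, Zsub Γ G u ≤ ballStab Γ G u 1)
include hZ

theorem Zsub_commute {u : α} {x y : G} (hx : x ∈ Zsub Γ G u) (hy : y ∈ Zsub Γ G u) :
    Commute x y := S.commute_of_mem_ball hy (hZ u hx)

theorem Zsub_sq {u : α} {x : G} (hx : x ∈ Zsub Γ G u) : x ^ 2 = 1 := by
  refine S.Zsub_induction (P := fun z => z ^ 2 = 1) (fun w hw x hx => (mem_Zuw.1 hx).2.2.2)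
    (one_pow 2) ?_ (fun x h => by rw [inv_pow, h, inv_one]) hx
  intro x y hx hy h1 h2
  rw [(S.Zsub_commute hZ hx hy).mul_pow, h1, h2, one_mul]

theorem mem_Zuw_of_commute {u p : α} {s z : G} (hp : Γ.Adj u p) (hs : IsLocalInv Γ u p s)
    (hz : z ∈ Zsub Γ G u) (h : Commute s z) : z ∈ Zuw G u p := by
  have hzu := (mem_ballStab_one S.conn).1 (hZ u hz)
  refine mem_Zuw.2 ⟨hzu.1, hzu.2 p hp, fun k hu hk => ?_, S.Zsub_sq hZ hz⟩
  rcases mem_ball_or_isLocalInv (Γ := Γ) hu hk with h1 | h1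
  · exact S.commute_of_mem_ball hz h1
  · have h2 := S.commute_of_mem_ball hz (S.inv_mul_mem hp hs h1)
    have h3 := h.inv_left.mul_left h2
    rwa [inv_mul_cancel_left] at h3

variable (hI : ∀ u p, Γ.Adj u p → ∀ a ∈ Zsub Γ G u, ∀ b ∈ Zsub Γ G u,
  a ∉ Zuw G u p → b ∉ Zuw G u p → a * b ∈ Zuw G u p)
include hI

theorem mem_Zuw_line {u i p : α} {a s : G} (hi : Γ.Adj u i) (hp : Γ.Adj u p)
    (hne : Zuw G u i ≠ Zuw G u p) (hs : IsLocalInv Γ u p s) (ha : a ∈ Zsub Γ G u) :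
    a ∈ Zuw G u i ∨ a ∈ Zuw G u p ∨ a ∈ Zuw G u (s • i) := by
  by_contra! hcon
  obtain ⟨ai, ap, asi⟩ := hcon
  have hsi := S.adj_of_fix hs.1 hi
  have hss : s⁻¹ • i = s • i := by
    rw [inv_smul_eq_iff, S.inv_inv hp hi hs hs]
  have hsa := S.conj_mem_Zsub_of_fix hs.1 ha
  have h1 : s * a * s⁻¹ ∉ Zuw G u i := by
    intro h
    have h2 := conj_mem_Zuw_of_fix (smul_inv_fix hs.1) h
    rw [hss] at h2
    apply asi
    convert h2 using 1
    group
  have h3 := hI u i hi _ hsa _ ha h1 ai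
  have h4 : ∀ x ∈ Zuw G u i, s * x * s⁻¹ ∈ Zuw G u i := by
    intro x hx
    by_cases hxp : x ∈ Zuw G u p
    · rwa [conj_eq_of_commute (commute_of_mem_Zuw hxp hs.1 hs.2.1)]
    · have h5 := hI u p hp a ha x (Zuw_le_Zsub hi hx) ap hxp
      have h6 := conj_eq_of_commute (commute_of_mem_Zuw h5 hs.1 hs.2.1)
      have h7 : s * a * s⁻¹ * (s * a * s⁻¹) = 1 := by
        rw [← pow_two]; exact S.Zsub_sq hZ hsa
      have h8 : s * x * s⁻¹ = s * a * s⁻¹ * a * x := by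
        calc s * x * s⁻¹ = s * a * s⁻¹ * (s * a * s⁻¹) * (s * x * s⁻¹) := by rw [h7, one_mul]
          _ = s * a * s⁻¹ * (s * (a * x) * s⁻¹) := by group
          _ = s * a * s⁻¹ * a * x := by rw [h6]; group
      rw [h8]
      exact mul_mem h3 hx
  have h5 : Zuw G u (s • i) ≤ Zuw G u i := by
    intro y hy
    have h6 := conj_mem_Zuw_of_fix (smul_inv_fix hs.1) hy
    rw [inv_smul_smul] at h6
    have h7 := h4 _ h6
    convert h7 using 1
    group
  obtain ⟨t, ht⟩ := S.inv_exists hi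
  refine hne (S.Zuw_eq_of_le hp hi fun x hx => ?_).symm
  have h6 := conj_mem_Zuw_of_fix (smul_inv_fix ht.1) hx
  have h7 : t⁻¹ • p = s • i := S.inv_comm hi hp ht.inv hs
  rw [h7] at h6
  have h8 := h5 h6
  have h9 := conj_eq_of_commute (commute_of_mem_Zuw h8 ht.1 ht.2.1)
  rw [← h9] at h8
  convert h8 using 1
  group

theorem mem_Zuw_of_mem_of_mem {u i p k : α} {z : G} (hi : Γ.Adj u i) (hp : Γ.Adj u p)
    (hk : Γ.Adj u k) (hne : Zuw G u i ≠ Zuw G u p) (hzi : z ∈ Zuw G u i)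
    (hzp : z ∈ Zuw G u p) : z ∈ Zuw G u k := by
  obtain ⟨s, hs⟩ := S.inv_exists hp
  obtain ⟨t, ht⟩ := S.inv_exists hk
  have main : ∀ q, Γ.Adj u q → z ∈ Zuw G u q → t * z * t⁻¹ ∈ Zuw G u q → z ∈ Zuw G u k := by
    intro q hq hz h1
    obtain ⟨c, hc⟩ := S.inv_exists hq
    have h2 := conj_mem_Zuw_of_fix (smul_inv_fix ht.1) h1
    rw [show t⁻¹ * (t * z * t⁻¹) * t⁻¹⁻¹ = z by group,
      S.inv_comm hk hq ht.inv hc] at h2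
    have h3 := conj_mem_Zuw_of_fix hc.1 h2
    rwa [S.inv_inv hq hk hc hc,
      conj_eq_of_commute (commute_of_mem_Zuw hz hc.1 hc.2.1)] at h3
  rcases S.mem_Zuw_line hZ hI hi hp hne hs
    (S.conj_mem_Zsub_of_fix ht.1 (Zuw_le_Zsub hi hzi)) with h | h | h
  · exact main i hi hzi h
  · exact main p hp hzp h
  · refine main _ (S.adj_of_fix hs.1 hi) ?_ h
    have h1 := conj_mem_Zuw_of_fix hs.1 hzi
    rwa [conj_eq_of_commute (commute_of_mem_Zuw hzp hs.1 hs.2.1)] at h1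

theorem commute_of_mem_of_mem {u i p : α} {z g : G} (hi : Γ.Adj u i) (hp : Γ.Adj u p)
    (hne : Zuw G u i ≠ Zuw G u p) (hzi : z ∈ Zuw G u i) (hzp : z ∈ Zuw G u p)
    (hg : g • u = u) : Commute g z := by
  obtain ⟨d, t, hd, ht, h1, -⟩ := S.exists_inv_swap hi (S.adj_of_fix hg hi)
  have h2 := commute_of_mem_Zuw (S.mem_Zuw_of_mem_of_mem hZ hI hi hp hd hne hzi hzp)
    ht.1 ht.2.1
  have h3 : Commute (t * g) z := commute_of_mem_Zuw hzi (by rw [mul_smul, hg, ht.1])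
    (by rw [mul_smul, h1])
  have h4 := h2.inv_left.mul_left h3
  rwa [inv_mul_cancel_left] at h4

end LocallyInversive

/-- The ends `u, u'` and `v', v` of a path joining a critical pair `(u, v)`. -/
structure CritEnds (Γ : SimpleGraph α) (G : Type*) [Group G] [MulAction G α]
    (u u' v' v : α) : Prop where
  adj_left : Γ.Adj u u'
  adj_right : Γ.Adj v v'
  le_right : Zsub Γ G u ≤ ballStab Γ G v' 1
  le_left : Zsub Γ G v ≤ ballStab Γ G u' 1
  next_le : Zsub Γ G u' ≤ ballStab Γ G v 1
  prev_le : Zsub Γ G v' ≤ ballStab Γ G u 1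
  not_le : ¬ Zsub Γ G u ≤ ballStab Γ G v 1

namespace CritEnds

theorem Zuw_le {u u' v' v : α} (C : CritEnds Γ G u u' v' v) : Zuw G u u' ≤ ballStab Γ G v 1 := by
  rw [Zuw_comm]
  exact (Zuw_le_Zsub C.adj_left.symm).trans C.next_le

variable (S : LocallyInversive Γ G) {u u' v' v : α} (C : CritEnds Γ G u u' v' v)
include S C

theorem isLocalInv {a : G} (ha : a ∈ Zsub Γ G u) (h : a ∉ ballStab Γ G v 1) :
    IsLocalInv Γ v v' a := by
  have h1 := (mem_ballStab_one S.conn).1 (C.le_right ha)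
  exact ⟨h1.2 v C.adj_right.symm, h1.1, h⟩

theorem symm : CritEnds Γ G v v' u' u where
  adj_left := C.adj_right
  adj_right := C.adj_left
  le_right := C.le_left
  le_left := C.le_right
  next_le := C.prev_le
  prev_le := C.next_le
  not_le := by
    intro h
    obtain ⟨t, ht, hn⟩ := SetLike.not_le_iff_exists.1 C.not_le
    exact S.not_commute_Zsub C.adj_right (C.isLocalInv S ht hn)
      fun z hz => (S.commute_of_mem_ball ht (h hz)).symm

variable (hZ : ∀ u, Zsub Γ G u ≤ ballStab Γ G u 1)
include hZ

theorem mem_Zuw_of_mem {z : G} (hz : z ∈ Zsub Γ G u) (h : z ∈ ballStab Γ G v 1) :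
    z ∈ Zuw G u u' := by
  obtain ⟨t, ht, hn⟩ := SetLike.not_le_iff_exists.1 (C.symm S).not_le
  exact S.mem_Zuw_of_commute hZ C.adj_left ((C.symm S).isLocalInv S ht hn) hz
    (S.commute_of_mem_ball ht h).symm

theorem index_two : ∀ x p, Γ.Adj x p → ∀ a ∈ Zsub Γ G x, ∀ b ∈ Zsub Γ G x,
    a ∉ Zuw G x p → b ∉ Zuw G x p → a * b ∈ Zuw G x p := by
  intro x p hp a ha b hb hna hnb
  obtain ⟨g, rfl, rfl⟩ := S.arc C.adj_left hp
  have tr : ∀ c ∈ Zsub Γ G (g • u), c ∉ Zuw G (g • u) (g • u') →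
      g⁻¹ * c * g ∈ Zsub Γ G u ∧ IsLocalInv Γ v v' (g⁻¹ * c * g) := by
    intro c hc hn
    have h1 := S.conj_mem_Zsub g⁻¹ hc
    rw [inv_smul_smul, inv_inv] at h1
    refine ⟨h1, C.isLocalInv S h1 fun h2 => hn ?_⟩
    have h3 := conj_mem_Zuw g (C.mem_Zuw_of_mem S hZ h1 h2)
    convert h3 using 1
    group
  obtain ⟨a1, a2⟩ := tr a ha hna
  obtain ⟨b1, b2⟩ := tr b hb hnb
  have h1 := C.mem_Zuw_of_mem S hZ (mul_mem a1 b1) (S.inv_mul_mem C.adj_right a2 b2)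
  convert conj_mem_Zuw g h1 using 1
  group

theorem exists_mem_inter : ∃ r : G, r ≠ 1 ∧ r ∈ Zuw G u u' ∧ r ∈ Zuw G v v' := by
  obtain ⟨a, ha, hna⟩ := SetLike.not_le_iff_exists.1 C.not_le
  obtain ⟨t, ht, hnt⟩ := SetLike.not_le_iff_exists.1 (C.symm S).not_le
  have hai := C.isLocalInv S ha hna
  have hti := (C.symm S).isLocalInv S ht hnt
  have h1 : a * t * a⁻¹ * t⁻¹ ∈ Zsub Γ G v :=
    mul_mem (S.conj_mem_Zsub_of_fix hai.1 ht) (inv_mem ht)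
  have h2 : a * t * a⁻¹ * t⁻¹ ∈ Zsub Γ G u := by
    have := mul_mem ha (S.conj_mem_Zsub_of_fix hti.1 (inv_mem ha))
    convert this using 1
    group
  refine ⟨a * t * a⁻¹ * t⁻¹, fun h => hna ?_, C.mem_Zuw_of_mem S hZ h2 (hZ v h1),
    (C.symm S).mem_Zuw_of_mem S hZ h1 (hZ u h2)⟩
  refine C.Zuw_le (S.mem_Zuw_of_commute hZ C.adj_left hti ha ?_)
  rw [mul_inv_eq_one, mul_inv_eq_iff_eq_mul] at h
  exact h.symm

theorem extend : ∃ p, Γ.Adj u p ∧ Zuw G u p ≠ Zuw G u u' ∧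
    ¬ Zsub Γ G p ≤ ballStab Γ G v' 1 := by
  by_contra! hcon
  obtain ⟨a, ha, hna⟩ := SetLike.not_le_iff_exists.1 C.not_le
  obtain ⟨t, ht, hnt⟩ := SetLike.not_le_iff_exists.1 (C.symm S).not_le
  have hai := C.isLocalInv S ha hna
  have hti := (C.symm S).isLocalInv S ht hnt
  have hu' := C.adj_left
  let M : α → Subgroup G := fun p => Zsub Γ G p ⊔ Zsub Γ G u
  have conjM : ∀ (g : G), g • u = u → ∀ p, ∀ x ∈ M p, g * x * g⁻¹ ∈ M (g • p) := by
    intro g hg p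
    have : M p ≤ (M (g • p)).comap (MulAut.conj g).toMonoidHom := by
      refine sup_le (fun x hx => ?_) fun x hx => ?_
      · exact (le_sup_left : Zsub Γ G (g • p) ≤ M (g • p)) (S.conj_mem_Zsub g hx)
      · exact (le_sup_right : Zsub Γ G u ≤ M (g • p)) (S.conj_mem_Zsub_of_fix hg hx)
    exact fun x hx => this hx
  have transport : ∀ (g : G), g • u = u → ∀ p q, M p ≤ M q → M (g • p) ≤ M (g • q) := by
    intro g hg p q h x hx
    have h1 := conjM g⁻¹ (smul_inv_fix hg) _ x hx
    rw [inv_smul_smul] at h1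
    have h2 := conjM g hg q _ (h h1)
    convert h2 using 1
    group
  have htM : ∀ p, Γ.Adj u p → Zuw G u p ≠ Zuw G u u' → M (t • p) ≤ M p := by
    intro p hp hne x hx
    have hle := hcon p hp hne
    have hstep : M p ≤ (M p).comap (MulAut.conj t).toMonoidHom := by
      refine sup_le (fun z hz => ?_) fun z hz => ?_
      · change t * z * t⁻¹ ∈ M p
        have hzM : z ∈ M p := (le_sup_left : Zsub Γ G p ≤ M p) hz
        by_cases hzv : z ∈ ballStab Γ G v 1
        · rwa [conj_eq_of_commute (S.commute_of_mem_ball ht hzv).symm]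
        · have hzb := (mem_ballStab_one S.conn).1 (hle hz)
          have hzi : IsLocalInv Γ v v' z := ⟨hzb.2 v C.adj_right.symm, hzb.1, hzv⟩
          have h1 := conj_eq_of_commute
            (S.commute_of_mem_ball ht (S.inv_mul_mem C.adj_right hai hzi)).symm
          have h2 : t * z * t⁻¹ = t * a⁻¹ * t⁻¹ * a * z := by
            calc t * z * t⁻¹ = t * a⁻¹ * t⁻¹ * (t * (a * z) * t⁻¹) := by group
              _ = t * a⁻¹ * t⁻¹ * a * z := by rw [h1]; group
          rw [h2]
          exact mul_mem ((le_sup_right : Zsub Γ G u ≤ M p)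
            (mul_mem (S.conj_mem_Zsub_of_fix hti.1 (inv_mem ha)) ha)) hzM
      · exact (le_sup_right : Zsub Γ G u ≤ M p) (S.conj_mem_Zsub_of_fix hti.1 hz)
    have h1 := conjM t⁻¹ (smul_inv_fix hti.1) _ x hx
    rw [inv_smul_smul] at h1
    have h2 : t * (t⁻¹ * x * t⁻¹⁻¹) * t⁻¹ ∈ M p := hstep h1
    convert h2 using 1
    group
  have good_smul : ∀ p, Γ.Adj u p → Zuw G u p ≠ Zuw G u u' →
      Zuw G u (t • p) ≠ Zuw G u u' := by
    intro p hp hne h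
    refine hne (S.Zuw_eq_of_le hp hu' fun x hx => ?_)
    have h1 := conj_mem_Zuw_of_fix hti.1 hx
    rw [h] at h1
    have h2 := conj_mem_Zuw_of_fix (smul_inv_fix hti.1) h1
    rw [smul_inv_fix hti.2.1] at h2
    convert h2 using 1
    group
  have good : ∀ p, Γ.Adj u p → Zuw G u p ≠ Zuw G u u' → M p = M u' := by
    intro p hp hne
    obtain ⟨s, hs⟩ := S.inv_exists hp
    have htp := S.adj_of_fix hti.1 hp
    have h1 := htM p hp hne
    have h2 := htM _ htp (good_smul p hp hne)
    rw [S.inv_inv hu' hp hti hti] at h2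
    have h3 : s • t • p = u' := by
      rw [S.inv_comm hu' hp hti hs, S.inv_inv hp hu' hs hs]
    have h4 := transport s hs.1 _ _ h1
    have h5 := transport s hs.1 _ _ h2
    rw [h3, hs.2.1] at h4 h5
    exact le_antisymm h5 h4
  have hex : ∃ p, Γ.Adj u p ∧ Zuw G u p ≠ Zuw G u u' := by
    by_contra! hno
    refine C.not_le fun x hx => ?_
    refine S.Zsub_induction (P := fun x => x ∈ ballStab Γ G v 1) ?_ (one_mem _)
      (fun x y _ _ => mul_mem) (fun x => inv_mem) hx
    intro w hw x hx
    rw [hno w hw] at hx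
    exact C.Zuw_le hx
  have all : ∀ p, Γ.Adj u p → M p = M u' := by
    intro p hp
    by_cases hne : Zuw G u p = Zuw G u u'
    · obtain ⟨g, hg, hgne⟩ := hex
      obtain ⟨s, hs⟩ := S.inv_exists hp
      have hq := S.adj_of_fix hs.1 hg
      have hqne : Zuw G u (s • g) ≠ Zuw G u u' := by
        intro h
        refine hgne (S.Zuw_eq_of_le hg hu' fun x hx => ?_)
        have h1 := conj_mem_Zuw_of_fix hs.1 hx
        rw [h, ← hne] at h1
        have h2 := commute_of_mem_Zuw h1 (smul_inv_fix hs.1)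
          (smul_inv_fix hs.2.1)
        have h3 := conj_eq_of_commute h2
        rw [← hne]
        rw [← h3] at h1
        convert h1 using 1
        group
      obtain ⟨c, hc⟩ := S.inv_exists hq
      have h1 : c • g = p := by
        rw [← S.inv_inv hg hp (S.inv_exists hg).choose_spec (S.inv_exists hg).choose_spec,
          ← S.inv_comm hp hg hs (S.inv_exists hg).choose_spec]
        exact (S.inv_comm hg hq (S.inv_exists hg).choose_spec hc).symm
      have h2 := transport c hc.1 _ _ ((good _ hg hgne).trans (good _ hq hqne).symm).le
      have h3 := transport c hc.1 _ _ ((good _ hg hgne).trans (good _ hq hqne).symm).ge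
      rw [h1, hc.2.1] at h2 h3
      exact (le_antisymm h2 h3).trans (good _ hq hqne)
    · exact good p hp hne
  obtain ⟨x, hx, hx1⟩ := S.exists_ne_one_mem_Zuw hu'
  have hMfix : M u' ≤ stabilizer G u ⊓ stabilizer G u' := by
    refine sup_le (fun z hz => ?_) fun z hz => ?_
    · have := (mem_ballStab_one S.conn).1 (hZ u' hz)
      exact ⟨this.2 u hu'.symm, this.1⟩
    · have := (mem_ballStab_one S.conn).1 (hZ u hz)
      exact ⟨this.1, this.2 u' hu'⟩
  refine hx1 (S.eq_one_of_swap hu' (M u' : Set G) (fun x hx => (hMfix hx).1)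
    (fun x hx => (hMfix hx).2) ?_ ?_ x
    ((le_sup_right : Zsub Γ G u ≤ M u') (Zuw_le_Zsub hu' hx)))
  · intro g hg y hy
    have h1 := conjM g hg u' y hy
    rwa [all _ (S.adj_of_fix hg hu')] at h1
  · intro g h1 h2 y hy
    have : M u' ≤ (M u').comap (MulAut.conj g).toMonoidHom := by
      refine sup_le (fun x hx => ?_) fun x hx => ?_
      · have h3 := S.conj_mem_Zsub g hx
        rw [h2] at h3
        exact (le_sup_right : Zsub Γ G u ≤ M u') h3
      · have h3 := S.conj_mem_Zsub g hx
        rw [h1] at h3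
        exact (le_sup_left : Zsub Γ G u' ≤ M u') h3
    exact this hy

end CritEnds

theorem dist_le_of_path (hconn : Γ.Connected) {f : ℕ → α} {N : ℕ}
    (hf : ∀ i < N, Γ.Adj (f i) (f (i + 1))) (i k : ℕ) (h : i + k ≤ N) :
    Γ.dist (f i) (f (i + k)) ≤ k := by
  induction k with
  | zero => simp
  | succ k ih =>
    have h1 := SimpleGraph.dist_eq_one_iff_adj.2 (hf (i + k) (by omega))
    have h2 := hconn.dist_triangle (u := f i) (v := f (i + k)) (w := f (i + k + 1))
    have h3 := ih (by omega)
    have h4 : i + (k + 1) = i + k + 1 := by ring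
    rw [h4]
    omega

/-- A sequence `f` whose first `N` steps are along edges. -/
def IsPathSeq (Γ : SimpleGraph α) (f : ℕ → α) (N : ℕ) : Prop :=
  ∀ i < N, Γ.Adj (f i) (f (i + 1))

theorem critEnds_of_path (hconn : Γ.Connected) {b : ℕ} (hb : 3 ≤ b)
    (hlt : ∀ u v, Γ.dist u v < b → Zsub Γ G u ≤ ballStab Γ G v 1) {f : ℕ → α} {N : ℕ}
    (hf : IsPathSeq Γ f N) (i : ℕ) (hi : i + b ≤ N)
    (hc : ¬ Zsub Γ G (f i) ≤ ballStab Γ G (f (i + b)) 1) :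
    CritEnds Γ G (f i) (f (i + 1)) (f (i + b - 1)) (f (i + b)) := by
  obtain ⟨c, rfl⟩ : ∃ c, b = c + 1 := ⟨b - 1, by omega⟩
  have e : i + (c + 1) - 1 = i + c := by omega
  have e2 : i + (c + 1) = i + 1 + c := by omega
  have h1 := dist_le_of_path hconn hf i c (by omega)
  have h2 := dist_le_of_path hconn hf (i + 1) c (by omega)
  rw [← e2] at h2
  rw [e]
  exact
    { adj_left := hf i (by omega)
      adj_right := (hf (i + c) (by omega)).symm
      le_right := hlt _ _ (by omega)
      le_left := hlt _ _ (by rw [SimpleGraph.dist_comm]; omega)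
      next_le := hlt _ _ (by omega)
      prev_le := hlt _ _ (by rw [SimpleGraph.dist_comm]; omega)
      not_le := hc }

theorem IsPathSeq.cons {f : ℕ → α} {N : ℕ} (hf : IsPathSeq Γ f N) {p : α}
    (hp : Γ.Adj p (f 0)) : IsPathSeq Γ (fun i => Nat.casesOn i p f) (N + 1) := by
  intro i hi
  cases i with
  | zero => exact hp
  | succ i => exact hf i (by omega)

theorem LocallyInversive.lt_three (S : LocallyInversive Γ G) {b : ℕ}
    (hlt : ∀ u v, Γ.dist u v < b → Zsub Γ G u ≤ ballStab Γ G v 1)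
    {u v : α} (huv : Γ.dist u v = b) (hc : ¬ Zsub Γ G u ≤ ballStab Γ G v 1) : b < 3 := by
  by_contra! hb
  have hZ : ∀ u, Zsub Γ G u ≤ ballStab Γ G u 1 := fun u => hlt u u (by simp; omega)
  obtain ⟨w, hw⟩ := S.conn.exists_walk_length_eq_dist u v
  rw [huv] at hw
  let f0 : ℕ → α := w.getVert
  have hf0 : IsPathSeq Γ f0 b := fun i hi => w.adj_getVert_succ (by omega)
  have e0 : f0 0 = u := w.getVert_zero
  have eb : f0 b = v := by rw [← hw]; exact w.getVert_length
  have C0 := critEnds_of_path S.conn hb hlt hf0 0 (by omega) (by rwa [zero_add, e0, eb])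
  obtain ⟨p, hp, hpne, hpc⟩ := C0.extend S hZ
  let f1 : ℕ → α := fun i => Nat.casesOn i p f0
  have hf1 : IsPathSeq Γ f1 (b + 1) := hf0.cons hp.symm
  have hc1 : ¬ Zsub Γ G (f1 0) ≤ ballStab Γ G (f1 (0 + b)) 1 := by
    obtain ⟨c, rfl⟩ : ∃ c, b = c + 1 := ⟨b - 1, by omega⟩
    rw [zero_add] at hpc ⊢
    exact hpc
  have C1 := critEnds_of_path S.conn hb hlt hf1 0 (by omega) hc1
  obtain ⟨q, hq, hqne, hqc⟩ := C1.extend S hZ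
  let f : ℕ → α := fun i => Nat.casesOn i q f1
  have hf : IsPathSeq Γ f (b + 2) := hf1.cons hq.symm
  have hc2 : ¬ Zsub Γ G (f 0) ≤ ballStab Γ G (f (0 + b)) 1 := by
    obtain ⟨c, rfl⟩ : ∃ c, b = c + 1 := ⟨b - 1, by omega⟩
    rw [zero_add] at hqc ⊢
    exact hqc
  have C2 := critEnds_of_path S.conn hb hlt hf 0 (by omega) hc2
  have I := C0.index_two S hZ
  obtain ⟨r, hr1, hr, hr'⟩ := C2.exists_mem_inter S hZ
  obtain ⟨c, rfl⟩ : ∃ c, b = c + 1 := ⟨b - 1, by omega⟩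
  simp only [zero_add, Nat.add_sub_cancel] at *
  have hqp : Γ.Adj q p := hq.symm
  have hpu : Γ.Adj p (f0 0) := hp.symm
  have hu1 : Γ.Adj (f0 0) (f0 1) := hf0 0 (by omega)
  have r1 : r ∈ Zuw G q p := hr
  have r2 : r ∈ Zuw G p q := by rwa [Zuw_comm]
  have r3 : r ∈ Zuw G p (f0 0) := by
    refine C1.mem_Zuw_of_mem S hZ (Zuw_le_Zsub hq r2) ?_
    have h1 : r ∈ Zsub Γ G (f (c + 1)) :=
      Zuw_le_Zsub (hf c (by omega)).symm hr'
    exact hlt (f (c + 1)) (f (c + 1 + 1))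
      (lt_of_le_of_lt (dist_le_of_path S.conn hf (c + 1) 1 (by omega)) (by omega)) h1
  have r4 : r ∈ Zuw G (f0 0) p := by rwa [Zuw_comm]
  have r5 : r ∈ Zuw G (f0 0) (f0 1) := by
    refine C0.mem_Zuw_of_mem S hZ (Zuw_le_Zsub hp r4) ?_
    have h1 : r ∈ Zsub Γ G (f (c + 1)) :=
      Zuw_le_Zsub (hf c (by omega)).symm hr'
    exact hlt (f (c + 1)) (f (c + 1 + 2))
      (lt_of_le_of_lt (dist_le_of_path S.conn hf (c + 1) 2 (by omega)) (by omega)) h1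
  refine hr1 (S.eq_one_of_invariant hpu {r} ?_ ?_ ?_ ?_ r rfl)
  · rintro x rfl; exact (mem_Zuw.1 r3).1
  · rintro x rfl; exact (mem_Zuw.1 r3).2.1
  · rintro g hg x rfl
    exact conj_eq_of_commute (S.commute_of_mem_of_mem hZ I hq hpu hqne r2 r3 hg)
  · rintro g hg x rfl
    exact conj_eq_of_commute (S.commute_of_mem_of_mem hZ I hp hu1 hpne r4 r5 hg)

end LocalInversions

theorem Lgrp_apply {n : ℕ} {l : Equiv.Perm (Vec n)} (hl : l ∈ Lgrp n) :
    (∃ w, ∀ v, l v = v + w) ∨ ∃ w, ∀ v, l v = -v + w := by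
  refine Subgroup.closure_induction
    (p := fun l _ => (∃ w, ∀ v, l v = v + w) ∨ ∃ w, ∀ v, l v = -v + w) ?_ ?_ ?_ ?_ hl
  · rintro l (h | rfl)
    · exact Or.inl h
    · exact Or.inr ⟨0, fun v => by simp⟩
  · exact Or.inl ⟨0, fun v => by simp⟩
  · rintro x y - - (⟨a, ha⟩ | ⟨a, ha⟩) (⟨b, hb⟩ | ⟨b, hb⟩)
    · exact Or.inl ⟨b + a, fun v => by rw [Equiv.Perm.mul_apply, hb, ha]; abel⟩
    · exact Or.inr ⟨b + a, fun v => by rw [Equiv.Perm.mul_apply, hb, ha]; abel⟩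
    · exact Or.inr ⟨-b + a, fun v => by rw [Equiv.Perm.mul_apply, hb, ha]; abel⟩
    · exact Or.inl ⟨-b + a, fun v => by rw [Equiv.Perm.mul_apply, hb, ha]; abel⟩
  · rintro x - (⟨a, ha⟩ | ⟨a, ha⟩)
    · exact Or.inl ⟨-a, fun v => by rw [Equiv.Perm.inv_eq_iff_eq, ha]; abel⟩
    · exact Or.inr ⟨a, fun v => by rw [Equiv.Perm.inv_eq_iff_eq, ha]; abel⟩

theorem exists_mem_Lgrp_neg_add {n : ℕ} (w : Vec n) :
    ∃ l ∈ Lgrp n, ∀ v, l v = -v + w := by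
  refine ⟨Equiv.addRight w * Equiv.neg (Vec n), mul_mem (Subgroup.subset_closure (Or.inl
    ⟨w, fun v => rfl⟩)) (Subgroup.subset_closure (Or.inr rfl)), fun v => by simp⟩

theorem Vec.add_self_add_self {n : ℕ} (v : Vec n) : v + v = -v := by
  funext i
  have : ∀ a : ZMod 3, a + a = -a := by decide
  exact this (v i)

/-- The structure of an inversion in terms of affine coordinates on the neighbourhood. -/
theorem LocallyL.smul_eq {α : Type*} {n : ℕ} {Γ : SimpleGraph α} {G : Type*} [Group G]
    [MulAction G α] (hball : ∀ {u : α} {g : G},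
      g • u = u → (∀ w, Γ.Adj u w → g • w = w) → g ∈ ballStab Γ G u 1)
    {u : α} {φ : Γ.neighborSet u ≃ Vec n}
    (hφ : ∀ g ∈ stabilizer G u, ∃ l ∈ Lgrp n, ∀ z : Γ.neighborSet u,
      ∃ hz : (g • (z : α)) ∈ Γ.neighborSet u, φ ⟨g • (z : α), hz⟩ = l (φ z))
    {p : α} (hp : Γ.Adj u p) {g : G} (hg : IsLocalInv Γ u p g) {q : α} (hq : Γ.Adj u q) :
    g • q = (φ.symm (-(φ ⟨p, hp⟩ + φ ⟨q, hq⟩)) : α) := by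
  obtain ⟨l, hl, h⟩ := hφ g hg.1
  have hcoe : ∀ z : Γ.neighborSet u, g • (z : α) = (φ.symm (l (φ z)) : α) := by
    intro z
    obtain ⟨hz, h1⟩ := h z
    rw [← h1, Equiv.symm_apply_apply]
  have hpp : l (φ ⟨p, hp⟩) = φ ⟨p, hp⟩ := by
    obtain ⟨hz, h1⟩ := h ⟨p, hp⟩
    rw [← h1]
    congr 1
    exact Subtype.ext hg.2.1
  rcases Lgrp_apply hl with ⟨w, hw⟩ | ⟨w, hw⟩
  · exfalso
    rw [hw, add_eq_left] at hpp
    refine hg.2.2 (hball hg.1 fun x hx => ?_)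
    have := hcoe ⟨x, hx⟩
    rwa [hw, hpp, add_zero, Equiv.symm_apply_apply] at this
  · have h1 := hcoe ⟨q, hq⟩
    rw [h1, hw]
    rw [hw] at hpp
    have h2 : w = -φ ⟨p, hp⟩ := by
      rw [← Vec.add_self_add_self]
      nth_rewrite 1 [← hpp]
      abel
    rw [h2, neg_add, add_comm]

theorem LocallyL.locallyInversive {α : Type*} {n : ℕ} (hn : 2 ≤ n) {Γ : SimpleGraph α}
    {G : Type*} [Group G] [MulAction G α] (hconn : Γ.Connected)
    (haut : ∀ (g : G) (u w : α), Γ.Adj u w ↔ Γ.Adj (g • u) (g • w))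
    (hfaith : ∀ g : G, (∀ u : α, g • u = u) → g = 1)
    (harc : ∀ u w u' w' : α, Γ.Adj u w → Γ.Adj u' w' → ∃ g : G, g • u = u' ∧ g • w = w')
    (hfin : ∀ u : α, Finite (stabilizer G u)) (hloc : LocallyL n Γ G) :
    LocallyInversive Γ G := by
  have hb' : ∀ {u : α} {g : G}, g • u = u → (∀ w, Γ.Adj u w → g • w = w) →
      g ∈ ballStab Γ G u 1 := fun h1 h2 => (mem_ballStab_one hconn).2 ⟨h1, h2⟩
  refine ⟨hconn, fun g u w h => (haut g u w).1 h, hfaith,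
    fun h h' => harc _ _ _ _ h h', hfin, ?_, ?_, ?_⟩
  · intro u p hp
    obtain ⟨φ, -, h2⟩ := hloc u
    obtain ⟨l, hl, hlv⟩ := exists_mem_Lgrp_neg_add (-φ ⟨p, hp⟩)
    obtain ⟨g, hg, h⟩ := h2 l hl
    have hlp : l (φ ⟨p, hp⟩) = φ ⟨p, hp⟩ := by
      rw [hlv, ← neg_add, Vec.add_self_add_self, neg_neg]
    refine ⟨g, hg, ?_, fun hgb => ?_⟩
    · obtain ⟨hz, h3⟩ := h ⟨p, hp⟩
      rw [hlp] at h3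
      exact congrArg Subtype.val (φ.injective h3)
    · have hfix : ∀ v, l v = v := by
        intro v
        obtain ⟨hz, h3⟩ := h (φ.symm v)
        rw [φ.apply_symm_apply] at h3
        rw [← h3, ← Equiv.eq_symm_apply]
        exact Subtype.ext (((mem_ballStab_one hconn).1 hgb).2 _ (φ.symm v).2)
      have h4 := hfix (φ ⟨p, hp⟩ + 1)
      rw [hlv, neg_add, add_right_comm, ← neg_add, Vec.add_self_add_self, neg_neg,
        add_right_inj] at h4
      have h5 := congrFun h4 ⟨0, by omega⟩
      revert h5
      change ¬ (-1 : ZMod 3) = 1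
      decide
  · intro u p q s t hp hq hs ht
    obtain ⟨φ, h1, -⟩ := hloc u
    rw [LocallyL.smul_eq hb' h1 hp hs hq, LocallyL.smul_eq hb' h1 hq ht hp, add_comm]
  · intro u p q s t hp hq hs ht
    obtain ⟨φ, h1, -⟩ := hloc u
    have ht' := LocallyL.smul_eq hb' h1 hp ht hq
    rw [ht', LocallyL.smul_eq hb' h1 hp hs (φ.symm _).2]
    simp

/-- the critical distance satisfies `b ≤ 2`. -/
theorem critDist_le_two
    {α : Type*} (n : ℕ) (hn : 2 ≤ n) (Γ : SimpleGraph α)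
    (G : Type*) [Group G] [MulAction G α]
    (hconn : Γ.Connected) (hacyc : Γ.IsAcyclic)
    (haut : ∀ (g : G) (u w : α), Γ.Adj u w ↔ Γ.Adj (g • u) (g • w))
    (hfaith : ∀ g : G, (∀ u : α, g • u = u) → g = 1)
    (harc : ∀ u w u' w' : α, Γ.Adj u w → Γ.Adj u' w' → ∃ g : G, g • u = u' ∧ g • w = w')
    (hfin : ∀ u : α, Finite (stabilizer G u))
    (hloc : LocallyL n Γ G)
    (x y : α) (hxy : Γ.Adj x y)
    (hntriv : ballStab Γ G x 1 ⊓ ballStab Γ G y 1 ≠ ⊥)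
 :
    critDist Γ G ≤ 2 := by
  have S := hloc.locallyInversive hn hconn haut hfaith harc hfin
  by_cases hne : {d : ℕ | ∃ u v : α, Γ.dist u v = d ∧ ¬ Zsub Γ G u ≤ ballStab Γ G v 1}.Nonempty
  · obtain ⟨u, v, huv, hc⟩ := Nat.sInf_mem hne
    refine Nat.le_of_lt_succ (S.lt_three (b := critDist Γ G) (fun a b hab => ?_) huv hc)
    by_contra h
    have hle : critDist Γ G ≤ Γ.dist a b := Nat.sInf_le ⟨a, b, rfl, h⟩
    exact absurd hle (not_le.2 hab)
  · rw [critDist, Set.not_nonempty_iff_eq_empty.1 hne]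
    simp
end
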